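/- For every integer n ≥ 1 there exists a bijection Φ : S_n → S_n such that for all σ∈S_n: nest σ = ress Φ(σ), cros σ = les Φ(σ), drop σ = des Φ(σ), cda σ = da Φ(σ) − fmax Φ(σ), cdd σ = dd Φ(σ), cvalley σ = valley Φ(σ), and fix σ = fmax Φ(σ). -/

import Mathlib

open scoped Classical
open Finset

noncomputable section

namespace SZpaper

/-- `σ` as a 1-indexed function on `[1,n]`, extended by `0` elsewhere
(boundary convention `σ(0)=σ(n+1)=0`). -/
def pext (n : ℕ) (σ : Equiv.Perm (Fin n)) (i : ℕ) : ℕ :=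
  if h : 1 ≤ i ∧ i ≤ n then ((σ ⟨i - 1, by omega⟩ : Fin n) : ℕ) + 1 else 0

/-- `σ` extended with the Brändén boundary convention `σ(0)=σ(n+1)=n+1`. -/
def pextB (n : ℕ) (σ : Equiv.Perm (Fin n)) (i : ℕ) : ℕ :=
  if h : 1 ≤ i ∧ i ≤ n then ((σ ⟨i - 1, by omega⟩ : Fin n) : ℕ) + 1 else n + 1

/-- `σ` extended with the boundary convention `σ(0)=0`, `σ(n+1)=n+1`. -/
def pextC (n : ℕ) (σ : Equiv.Perm (Fin n)) (i : ℕ) : ℕ :=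
  if h : 1 ≤ i ∧ i ≤ n then ((σ ⟨i - 1, by omega⟩ : Fin n) : ℕ) + 1
  else if i = 0 then 0 else n + 1

/-- The set of pairs `(i,j)` with `i, j ∈ [1,n]`. -/
def pairs (n : ℕ) : Finset (ℕ × ℕ) := Finset.Icc 1 n ×ˢ Finset.Icc 1 n

/-- `des σ = #{i ∈ [n−1] : σ(i) > σ(i+1)}`. -/
def desStat (n : ℕ) (σ : Equiv.Perm (Fin n)) : ℕ :=
  ((Finset.Icc 1 (n - 1)).filter fun i => pext n σ (i + 1) < pext n σ i).card

/-- `les σ = #{(i,j) : 2 ≤ i < j ≤ n, σ(i−1) > σ(j) > σ(i)}`. -/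
def lesStat (n : ℕ) (σ : Equiv.Perm (Fin n)) : ℕ :=
  ((pairs n).filter fun x => 2 ≤ x.1 ∧ x.1 < x.2 ∧
    pext n σ x.1 < pext n σ x.2 ∧ pext n σ x.2 < pext n σ (x.1 - 1)).card

/-- `less σ = #{(i,j) : 2 ≤ i < j ≤ n, σ(i−1) < σ(j) < σ(i)}`. -/
def lessStat (n : ℕ) (σ : Equiv.Perm (Fin n)) : ℕ :=
  ((pairs n).filter fun x => 2 ≤ x.1 ∧ x.1 < x.2 ∧
    pext n σ (x.1 - 1) < pext n σ x.2 ∧ pext n σ x.2 < pext n σ x.1).card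

/-- `res σ = #{(i,j) : 1 ≤ i < j ≤ n−1, σ(j+1) > σ(i) > σ(j)}`. -/
def resStat (n : ℕ) (σ : Equiv.Perm (Fin n)) : ℕ :=
  ((pairs n).filter fun x => x.1 < x.2 ∧ x.2 ≤ n - 1 ∧
    pext n σ x.2 < pext n σ x.1 ∧ pext n σ x.1 < pext n σ (x.2 + 1)).card

/-- `ress σ = #{(i,j) : 1 ≤ i < j ≤ n−1, σ(j+1) < σ(i) < σ(j)}`. -/
def ressStat (n : ℕ) (σ : Equiv.Perm (Fin n)) : ℕ :=
  ((pairs n).filter fun x => x.1 < x.2 ∧ x.2 ≤ n - 1 ∧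
    pext n σ (x.2 + 1) < pext n σ x.1 ∧ pext n σ x.1 < pext n σ x.2).card

/-! Linear statistics with the boundary convention `σ(0)=σ(n+1)=0` (starred). -/

def peakStar (n : ℕ) (σ : Equiv.Perm (Fin n)) : ℕ :=
  ((Finset.Icc 1 n).filter fun i =>
    pext n σ (i - 1) < pext n σ i ∧ pext n σ (i + 1) < pext n σ i).card

def valleyStar (n : ℕ) (σ : Equiv.Perm (Fin n)) : ℕ :=
  ((Finset.Icc 1 n).filter fun i =>
    pext n σ i < pext n σ (i - 1) ∧ pext n σ i < pext n σ (i + 1)).card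

def daStar (n : ℕ) (σ : Equiv.Perm (Fin n)) : ℕ :=
  ((Finset.Icc 1 n).filter fun i =>
    pext n σ (i - 1) < pext n σ i ∧ pext n σ i < pext n σ (i + 1)).card

def ddStar (n : ℕ) (σ : Equiv.Perm (Fin n)) : ℕ :=
  ((Finset.Icc 1 n).filter fun i =>
    pext n σ (i + 1) < pext n σ i ∧ pext n σ i < pext n σ (i - 1)).card

/-! Linear statistics with the Brändén boundary convention `σ(0)=σ(n+1)=n+1`. -/

def peakB (n : ℕ) (σ : Equiv.Perm (Fin n)) : ℕ :=
  ((Finset.Icc 1 n).filter fun i =>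
    pextB n σ (i - 1) < pextB n σ i ∧ pextB n σ (i + 1) < pextB n σ i).card

def valleyB (n : ℕ) (σ : Equiv.Perm (Fin n)) : ℕ :=
  ((Finset.Icc 1 n).filter fun i =>
    pextB n σ i < pextB n σ (i - 1) ∧ pextB n σ i < pextB n σ (i + 1)).card

def daB (n : ℕ) (σ : Equiv.Perm (Fin n)) : ℕ :=
  ((Finset.Icc 1 n).filter fun i =>
    pextB n σ (i - 1) < pextB n σ i ∧ pextB n σ i < pextB n σ (i + 1)).card

def ddB (n : ℕ) (σ : Equiv.Perm (Fin n)) : ℕ :=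
  ((Finset.Icc 1 n).filter fun i =>
    pextB n σ (i + 1) < pextB n σ i ∧ pextB n σ i < pextB n σ (i - 1)).card

/-! Linear statistics with the boundary convention `σ(0)=0`, `σ(n+1)=n+1`. -/

def valleyC (n : ℕ) (σ : Equiv.Perm (Fin n)) : ℕ :=
  ((Finset.Icc 1 n).filter fun i =>
    pextC n σ i < pextC n σ (i - 1) ∧ pextC n σ i < pextC n σ (i + 1)).card

def daC (n : ℕ) (σ : Equiv.Perm (Fin n)) : ℕ :=
  ((Finset.Icc 1 n).filter fun i =>
    pextC n σ (i - 1) < pextC n σ i ∧ pextC n σ i < pextC n σ (i + 1)).card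

def ddC (n : ℕ) (σ : Equiv.Perm (Fin n)) : ℕ :=
  ((Finset.Icc 1 n).filter fun i =>
    pextC n σ (i + 1) < pextC n σ i ∧ pextC n σ i < pextC n σ (i - 1)).card

/-- `fmax σ`: the number of double ascents (convention `σ(0)=0`, `σ(n+1)=n+1`)
which are left-to-right maxima. -/
def fmaxStat (n : ℕ) (σ : Equiv.Perm (Fin n)) : ℕ :=
  ((Finset.Icc 1 n).filter fun i =>
    pextC n σ (i - 1) < pextC n σ i ∧ pextC n σ i < pextC n σ (i + 1) ∧
    ∀ j ∈ Finset.Ico 1 i, pext n σ j < pext n σ i).card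

/-! Cyclic statistics. -/

def excStat (n : ℕ) (σ : Equiv.Perm (Fin n)) : ℕ :=
  ((Finset.Icc 1 n).filter fun i => i < pext n σ i).card

def wexStat (n : ℕ) (σ : Equiv.Perm (Fin n)) : ℕ :=
  ((Finset.Icc 1 n).filter fun i => i ≤ pext n σ i).card

def dropStat (n : ℕ) (σ : Equiv.Perm (Fin n)) : ℕ :=
  ((Finset.Icc 1 n).filter fun i => pext n σ i < i).card

def fixStat (n : ℕ) (σ : Equiv.Perm (Fin n)) : ℕ :=
  ((Finset.Icc 1 n).filter fun i => pext n σ i = i).card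

/-- cyclic valleys: `x` with `σ⁻¹(x) > x < σ(x)`. -/
def cvalleyStat (n : ℕ) (σ : Equiv.Perm (Fin n)) : ℕ :=
  ((Finset.Icc 1 n).filter fun x => x < pext n σ⁻¹ x ∧ x < pext n σ x).card

/-- double excedances: `x` with `σ⁻¹(x) < x < σ(x)`. -/
def cdaStat (n : ℕ) (σ : Equiv.Perm (Fin n)) : ℕ :=
  ((Finset.Icc 1 n).filter fun x => pext n σ⁻¹ x < x ∧ x < pext n σ x).card

/-- double drops: `x` with `σ⁻¹(x) > x > σ(x)`. -/
def cddStat (n : ℕ) (σ : Equiv.Perm (Fin n)) : ℕ :=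
  ((Finset.Icc 1 n).filter fun x => x < pext n σ⁻¹ x ∧ pext n σ x < x).card

/-- crossings. -/
def crosStat (n : ℕ) (σ : Equiv.Perm (Fin n)) : ℕ :=
  ((pairs n).filter fun x =>
    (x.1 < x.2 ∧ x.2 ≤ pext n σ x.1 ∧ pext n σ x.1 < pext n σ x.2) ∨
    (x.2 < x.1 ∧ pext n σ x.1 < x.2 ∧ pext n σ x.2 < pext n σ x.1)).card

/-- nestings. -/
def nestStat (n : ℕ) (σ : Equiv.Perm (Fin n)) : ℕ :=
  ((pairs n).filter fun x =>
    (x.1 < x.2 ∧ x.2 ≤ pext n σ x.2 ∧ pext n σ x.2 < pext n σ x.1) ∨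
    (x.2 < x.1 ∧ pext n σ x.2 < x.2 ∧ pext n σ x.1 < pext n σ x.2)).card

/-- number of cycles of `σ` (fixed points count as cycles). -/
def cycStat (n : ℕ) (σ : Equiv.Perm (Fin n)) : ℕ :=
  Multiset.card σ.cycleType + (Finset.univ.filter fun x => σ x = x).card

/-! Star statistics: `σ*(i) = σ(i) − 1`, a bijection `[n] → {0,…,n−1}`;
we extend `σ*` by `0` outside `[1,n]`. -/

def starf (n : ℕ) (σ : Equiv.Perm (Fin n)) (i : ℕ) : ℕ :=
  if 1 ≤ i ∧ i ≤ n then pext n σ i - 1 else 0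

/-- `(σ*)⁻¹(i) = σ⁻¹(i+1)`, defined for `0 ≤ i ≤ n−1`. -/
def invstarf (n : ℕ) (σ : Equiv.Perm (Fin n)) (i : ℕ) : ℕ :=
  pext n σ⁻¹ (i + 1)

def dropStarStat (n : ℕ) (σ : Equiv.Perm (Fin n)) : ℕ :=
  ((Finset.Icc 1 n).filter fun i => starf n σ i < i).card

def fixStarStat (n : ℕ) (σ : Equiv.Perm (Fin n)) : ℕ :=
  ((Finset.Icc 1 n).filter fun i => starf n σ i = i).card

def wexStarStat (n : ℕ) (σ : Equiv.Perm (Fin n)) : ℕ :=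
  ((Finset.Icc 1 n).filter fun i => i ≤ starf n σ i).card

def cdaStarStat (n : ℕ) (σ : Equiv.Perm (Fin n)) : ℕ :=
  ((Finset.Icc 1 n).filter fun i => invstarf n σ i < i ∧ i < starf n σ i).card

def cddStarStat (n : ℕ) (σ : Equiv.Perm (Fin n)) : ℕ :=
  ((Finset.Icc 1 n).filter fun i => i < invstarf n σ i ∧ starf n σ i < i).card

def cvalleyStarStat (n : ℕ) (σ : Equiv.Perm (Fin n)) : ℕ :=
  ((Finset.Icc 1 n).filter fun i => i < invstarf n σ i ∧ i < starf n σ i).card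

def crosStarStat (n : ℕ) (σ : Equiv.Perm (Fin n)) : ℕ :=
  ((pairs n).filter fun x =>
    (x.1 < x.2 ∧ x.2 ≤ starf n σ x.1 ∧ starf n σ x.1 < starf n σ x.2) ∨
    (x.2 < x.1 ∧ starf n σ x.1 < x.2 ∧ starf n σ x.2 < starf n σ x.1)).card

def nestStarStat (n : ℕ) (σ : Equiv.Perm (Fin n)) : ℕ :=
  ((pairs n).filter fun x =>
    (x.1 < x.2 ∧ x.2 ≤ starf n σ x.2 ∧ starf n σ x.2 < starf n σ x.1) ∨
    (x.2 < x.1 ∧ starf n σ x.2 < x.2 ∧ starf n σ x.1 < starf n σ x.2)).card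

/-- `cyc* σ`: the number of cycles of the functional digraph of `σ*` on `[n]`,
counted as the number of `i ∈ [1,n]` that lie on a cycle of `σ*` and are
minimal in their cycle. (The component of `σ*` that is a path from `n` to `0`
contributes no such `i`.) -/
def cycStarStat (n : ℕ) (σ : Equiv.Perm (Fin n)) : ℕ :=
  ((Finset.Icc 1 n).filter fun i =>
    (∃ m ∈ Finset.Icc 1 n, (starf n σ)^[m] i = i) ∧
    ∀ m ∈ Finset.range (n + 1), i ≤ (starf n σ)^[m] i).card

/-! Motzkin paths, encoded as step sequences `γ : Fin m → Fin 3`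
(`0` = up step `(1,1)`, `1` = level step `(1,0)`, `2` = down step `(1,−1)`). -/

/-- The height (ordinate) of the path after `i` steps. -/
def hgt (m : ℕ) (γ : Fin m → Fin 3) (i : ℕ) : ℤ :=
  ∑ j ∈ Finset.range i, if hj : j < m then 1 - ((γ ⟨j, hj⟩ : ℕ) : ℤ) else 0

/-- A step sequence is a Motzkin path if it never goes below the x-axis and
ends at height `0`. -/
def IsMotzkin (m : ℕ) (γ : Fin m → Fin 3) : Prop :=
  (∀ i ≤ m, 0 ≤ hgt m γ i) ∧ hgt m γ m = 0

/-- The (finite) set of Motzkin paths of length `m`. -/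
def motzkin (m : ℕ) : Finset (Fin m → Fin 3) :=
  Finset.univ.filter fun γ => IsMotzkin m γ

/-- number of up (North-East) steps. -/
def neCount (m : ℕ) (γ : Fin m → Fin 3) : ℕ :=
  (Finset.univ.filter fun i => γ i = 0).card

/-- number of level (East) steps. -/
def eCount (m : ℕ) (γ : Fin m → Fin 3) : ℕ :=
  (Finset.univ.filter fun i => γ i = 1).card

/-- the `(p,q)`-integer `[m]_{p,q} = p^{m−1} + p^{m−2}q + ⋯ + q^{m−1}`. -/
def pqInt {R : Type*} [CommRing R] (p q : R) (m : ℕ) : R :=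
  ∑ j ∈ Finset.range m, p ^ (m - 1 - j) * q ^ j

section

variable {n : ℕ} (τ : Equiv.Perm (Fin n))

lemma pext_mem {i : ℕ} (hi : 1 ≤ i ∧ i ≤ n) : 1 ≤ pext n τ i ∧ pext n τ i ≤ n := by
  unfold pext
  rw [dif_pos hi]
  omega

lemma pext_inv_pext {i : ℕ} (hi : 1 ≤ i ∧ i ≤ n) : pext n τ⁻¹ (pext n τ i) = i := by
  have h := pext_mem τ hi
  unfold pext at h ⊢
  rw [dif_pos hi] at h ⊢
  rw [dif_pos h]
  simp only [Nat.add_sub_cancel, Fin.eta, Equiv.Perm.coe_inv, Equiv.symm_apply_apply]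
  omega

lemma pext_pext_inv {x : ℕ} (hx : 1 ≤ x ∧ x ≤ n) : pext n τ (pext n τ⁻¹ x) = x := by
  simpa using pext_inv_pext τ⁻¹ hx

lemma pext_eq_iff {i x : ℕ} (hi : 1 ≤ i ∧ i ≤ n) (hx : 1 ≤ x ∧ x ≤ n) :
    pext n τ i = x ↔ i = pext n τ⁻¹ x :=
  ⟨fun h => by rw [← h, pext_inv_pext τ hi], fun h => by rw [h, pext_pext_inv τ hx]⟩

lemma sum_pext (f : ℕ → ℕ) : ∑ i ∈ Icc 1 n, f (pext n τ i) = ∑ x ∈ Icc 1 n, f x := by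
  refine Finset.sum_nbij' (pext n τ) (pext n τ⁻¹) ?_ ?_ ?_ ?_ (fun _ _ => rfl)
  · intro i hi; rw [mem_Icc] at hi ⊢; exact pext_mem τ hi
  · intro i hi; rw [mem_Icc] at hi ⊢; exact pext_mem τ⁻¹ hi
  · intro i hi; exact pext_inv_pext τ (mem_Icc.1 hi)
  · intro i hi; exact pext_pext_inv τ (mem_Icc.1 hi)

lemma card_filter_pext (Q : ℕ → Prop) [DecidablePred Q] :
    ((Icc 1 n).filter fun i => Q (pext n τ i)).card = ((Icc 1 n).filter Q).card := by
  simp only [card_filter]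
  exact sum_pext τ fun x => if Q x then 1 else 0

/-- The set of descent tops. -/
def tops : Finset ℕ :=
  (Icc 1 n).filter fun x => pext n τ⁻¹ x < n ∧ pext n τ (pext n τ⁻¹ x + 1) < x

/-- The set of descent bottoms. -/
def bots : Finset ℕ :=
  (Icc 1 n).filter fun x => x < pext n τ (pext n τ⁻¹ x - 1)

/-- The number of descents to the left of the value `x` which straddle `x`. -/
def lesAt (x : ℕ) : ℕ :=
  ((Icc 1 n).filter fun i => 2 ≤ i ∧ i < pext n τ⁻¹ x ∧
    pext n τ i < x ∧ x < pext n τ (i - 1)).card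

/-- The number of descents to the right of the value `x` which straddle `x`. -/
def ressAt (x : ℕ) : ℕ :=
  ((Icc 1 n).filter fun j => pext n τ⁻¹ x < j ∧ j ≤ n - 1 ∧
    pext n τ (j + 1) < x ∧ x < pext n τ j).card

/-- The number of steps from above `k` to at most `k` ending at or before position `q`. -/
def dropsBelow (k q : ℕ) : ℕ :=
  ((Icc 2 n).filter fun i => i ≤ q ∧ k < pext n τ (i - 1) ∧ pext n τ i ≤ k).card

variable {τ}

lemma pext_mem_tops {i : ℕ} (hi : 1 ≤ i ∧ i ≤ n) :
    pext n τ i ∈ tops τ ↔ i < n ∧ pext n τ (i + 1) < pext n τ i := by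
  simp [tops, pext_inv_pext τ hi, pext_mem τ hi]

lemma pext_mem_bots {i : ℕ} (hi : 1 ≤ i ∧ i ≤ n) :
    pext n τ i ∈ bots τ ↔ pext n τ i < pext n τ (i - 1) := by
  simp [bots, pext_inv_pext τ hi, pext_mem τ hi]

lemma pext_zero : pext n τ 0 = 0 := by simp [pext]

variable (τ)

lemma card_filter_tops (P : ℕ → Prop) [DecidablePred P] :
    ((tops τ).filter P).card = ((Icc 1 (n - 1)).filter fun i =>
      pext n τ (i + 1) < pext n τ i ∧ P (pext n τ i)).card := by
  rw [tops, filter_filter, ← card_filter_pext τ]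
  congr 1
  ext i
  simp only [mem_filter, mem_Icc]
  constructor
  · rintro ⟨hi, h⟩
    rw [pext_inv_pext τ hi] at h
    exact ⟨by omega, h.1.2, h.2⟩
  · rintro ⟨hi, h⟩
    have hi' : 1 ≤ i ∧ i ≤ n := by omega
    rw [pext_inv_pext τ hi']
    exact ⟨hi', ⟨by omega, h.1⟩, h.2⟩

lemma card_filter_bots (P : ℕ → Prop) [DecidablePred P] :
    ((bots τ).filter P).card = ((Icc 1 (n - 1)).filter fun i =>
      pext n τ (i + 1) < pext n τ i ∧ P (pext n τ (i + 1))).card := by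
  rw [bots, filter_filter, ← card_filter_pext τ]
  symm
  refine card_nbij' (· + 1) (· - 1) ?_ ?_ ?_ ?_
  · intro i hi
    simp only [coe_filter, mem_Icc, Set.mem_ofPred_eq] at hi ⊢
    have hi' : 1 ≤ i + 1 ∧ i + 1 ≤ n := by omega
    rw [pext_inv_pext τ hi']
    exact ⟨hi', hi.2⟩
  · intro i hi
    simp only [coe_filter, mem_Icc, Set.mem_ofPred_eq] at hi ⊢
    obtain ⟨hi, h⟩ := hi
    rw [pext_inv_pext τ hi] at h
    have : i ≠ 1 := by
      rintro rfl
      simp [pext_zero] at h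
    rw [show i - 1 + 1 = i by omega]
    exact ⟨by omega, h⟩
  · intro i _; simp
  · intro i hi
    simp only [coe_filter, mem_Icc, Set.mem_ofPred_eq] at hi ⊢
    omega

lemma desStat_eq_card_tops : desStat n τ = (tops τ).card := by
  simpa [desStat] using (card_filter_tops τ fun _ => True).symm

lemma card_bots_eq_card_tops : (bots τ).card = (tops τ).card := by
  simpa using (card_filter_bots τ fun _ => True).trans (card_filter_tops τ fun _ => True).symm

lemma lesStat_eq_sum : lesStat n τ = ∑ x ∈ Icc 1 n, lesAt τ x := by
  rw [← sum_pext τ, lesStat, card_filter, pairs, sum_product_right]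
  refine sum_congr rfl fun j hj => ?_
  rw [lesAt, pext_inv_pext τ (mem_Icc.1 hj), card_filter]

lemma ressStat_eq_sum : ressStat n τ = ∑ x ∈ Icc 1 n, ressAt τ x := by
  rw [← sum_pext τ, ressStat, card_filter, pairs, sum_product]
  refine sum_congr rfl fun j hj => ?_
  rw [ressAt, pext_inv_pext τ (mem_Icc.1 hj), card_filter]

variable {τ}

lemma lesAt_add_ressAt {x : ℕ} (hx : 1 ≤ x ∧ x ≤ n) :
    lesAt τ x + ressAt τ x + ((tops τ).filter (· ≤ x)).card = ((bots τ).filter (· < x)).card := by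
  have hl : lesAt τ x = ((Icc 1 (n - 1)).filter fun i => i < pext n τ⁻¹ x ∧
      pext n τ (i + 1) < x ∧ x < pext n τ i).card := by
    symm
    refine card_nbij' (· + 1) (· - 1) ?_ ?_ ?_ ?_
    · intro i hi
      simp only [coe_filter, mem_Icc, Set.mem_ofPred_eq] at hi ⊢
      have := pext_eq_iff τ (i := i + 1) (by omega) hx
      simp only [Nat.add_sub_cancel]
      omega
    · intro i hi
      simp only [coe_filter, mem_Icc, Set.mem_ofPred_eq] at hi ⊢
      rw [show i - 1 + 1 = i by omega]
      omega
    · intro i _; simp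
    · intro i hi
      simp only [coe_filter, mem_Icc, Set.mem_ofPred_eq] at hi ⊢
      omega
  have hr : ressAt τ x = ((Icc 1 (n - 1)).filter fun i => pext n τ⁻¹ x < i ∧
      pext n τ (i + 1) < x ∧ x < pext n τ i).card := by
    unfold ressAt
    congr 1
    ext i
    simp only [mem_filter, mem_Icc]
    omega
  rw [hl, hr, card_filter_tops, card_filter_bots]
  simp only [card_filter, ← sum_add_distrib]
  refine sum_congr rfl fun i hi => ?_
  rw [mem_Icc] at hi
  have := pext_eq_iff τ (i := i) (by omega) hx
  split_ifs <;> omega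

lemma exists_drop_between {k q r : ℕ} (hqr : q ≤ r) (hq : k < pext n τ q)
    (hr : pext n τ r ≤ k) :
    ∃ i, q < i ∧ i ≤ r ∧ k < pext n τ (i - 1) ∧ pext n τ i ≤ k := by
  induction r, hqr using Nat.le_induction with
  | base => omega
  | succ r hqr ih =>
    by_cases h : pext n τ r ≤ k
    · obtain ⟨i, hi⟩ := ih h
      exact ⟨i, by omega, by omega, hi.2.2⟩
    · exact ⟨r + 1, by omega, le_rfl, by simpa using h, hr⟩

lemma dropsBelow_mono (k : ℕ) {q r : ℕ} (hqr : q ≤ r) : dropsBelow τ k q ≤ dropsBelow τ k r :=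
  card_le_card <| monotone_filter_right _ fun _ _ h => ⟨h.1.trans hqr, h.2⟩

lemma dropsBelow_lt {k q r : ℕ} (hq1 : 1 ≤ q) (hrn : r ≤ n) (hqr : q ≤ r)
    (hq : k < pext n τ q) (hr : pext n τ r ≤ k) : dropsBelow τ k q < dropsBelow τ k r := by
  obtain ⟨i, h1, h2, h3⟩ := exists_drop_between hqr hq hr
  refine card_lt_card ⟨monotone_filter_right _ fun _ _ h => ⟨h.1.trans hqr, h.2⟩, fun h => ?_⟩
  have := h (mem_filter.2 ⟨mem_Icc.2 (by omega), h2, h3⟩)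
  rw [mem_filter] at this
  omega

lemma lesAt_eq_dropsBelow {k : ℕ} (hk : k + 1 ≤ n) :
    lesAt τ (k + 1) = dropsBelow τ k (pext n τ⁻¹ (k + 1)) := by
  unfold lesAt dropsBelow
  congr 1
  ext i
  simp only [mem_filter, mem_Icc]
  have h1 := fun h => pext_eq_iff τ (i := i) (x := k + 1) h (by omega)
  have h2 := fun h => pext_eq_iff τ (i := i - 1) (x := k + 1) h (by omega)
  constructor <;> intro h <;> have h1 := h1 (by omega) <;> have h2 := h2 (by omega) <;> omega

lemma dropsBelow_succ {k q : ℕ} (hk : k + 1 ≤ n) (hq : q ≤ n) :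
    dropsBelow τ (k + 1) q + (if k + 1 ∈ tops τ ∧ pext n τ⁻¹ (k + 1) < q then 1 else 0) =
      dropsBelow τ k q + (if k + 1 ∈ bots τ ∧ pext n τ⁻¹ (k + 1) ≤ q then 1 else 0) := by
  set z := pext n τ⁻¹ (k + 1) with hz
  have hz1 : 1 ≤ z ∧ z ≤ n := pext_mem τ⁻¹ (by omega)
  have hzk : pext n τ z = k + 1 := pext_pext_inv τ (by omega)
  have ht : k + 1 ∈ tops τ ↔ z < n ∧ pext n τ (z + 1) < k + 1 := by
    simp [← hzk, pext_mem_tops hz1]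
  have hb : k + 1 ∈ bots τ ↔ k + 1 < pext n τ (z - 1) := by
    simp [← hzk, pext_mem_bots hz1]
  have e1 : (if k + 1 ∈ tops τ ∧ z < q then 1 else 0) =
      ∑ i ∈ Icc 2 n, if i = z + 1 ∧ i ≤ q ∧ pext n τ i < k + 1 then 1 else 0 := by
    simp only [ht]
    split_ifs with h
    · rw [sum_eq_single (z + 1)]
      · rw [if_pos]; omega
      · intro i _ hi; rw [if_neg]; omega
      · intro h'; rw [mem_Icc] at h'; omega
    · symm
      refine sum_eq_zero fun i hi => if_neg ?_
      rintro ⟨rfl, h'⟩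
      omega
  have e2 : (if k + 1 ∈ bots τ ∧ z ≤ q then 1 else 0) =
      ∑ i ∈ Icc 2 n, if i = z ∧ i ≤ q ∧ k + 1 < pext n τ (i - 1) then 1 else 0 := by
    simp only [hb]
    split_ifs with h
    · have : z ≠ 1 := by
        rintro h'
        simp [h', pext_zero] at h
      rw [sum_eq_single z]
      · rw [if_pos]; omega
      · intro i _ hi; rw [if_neg]; omega
      · intro h'; rw [mem_Icc] at h'; omega
    · symm
      refine sum_eq_zero fun i hi => if_neg ?_
      rintro ⟨rfl, h'⟩
      omega
  rw [e1, e2]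
  simp only [dropsBelow, card_filter, ← sum_add_distrib]
  refine sum_congr rfl fun i hi => ?_
  rw [mem_Icc] at hi
  have h1 := pext_eq_iff τ (i := i) (x := k + 1) (by omega) (by omega)
  have h2 := pext_eq_iff τ (i := i - 1) (x := k + 1) (by omega) (by omega)
  rw [← hz] at h1 h2
  split_ifs <;> omega

lemma pext_inv_lt_iff {k x : ℕ} (hk : k + 1 ≤ n) (hx : 1 ≤ x ∧ x ≤ k) :
    pext n τ⁻¹ x < pext n τ⁻¹ (k + 1) ↔ dropsBelow τ k (pext n τ⁻¹ x) ≤ lesAt τ (k + 1) := by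
  rw [lesAt_eq_dropsBelow hk]
  refine ⟨fun h => dropsBelow_mono k h.le, fun h => ?_⟩
  by_contra hlt
  have := dropsBelow_lt (τ := τ) (k := k) (pext_mem τ⁻¹ (i := k + 1) (by omega)).1
    (pext_mem τ⁻¹ (i := x) (by omega)).2 (not_lt.1 hlt)
    (by rw [pext_pext_inv τ (by omega)]; omega) (by rw [pext_pext_inv τ (by omega)]; omega)
  omega

lemma pext_inv_ne {x y : ℕ} (hx : 1 ≤ x ∧ x ≤ n) (hy : 1 ≤ y ∧ y ≤ n) (h : x ≠ y) :
    pext n τ⁻¹ x ≠ pext n τ⁻¹ y := fun h' => h <| by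
  rw [← pext_pext_inv τ hx, h', pext_pext_inv τ hy]

/-- A permutation is determined by its descent tops, its descent bottoms and its left labels. -/
theorem eq_of_tops_bots_lesAt {τ τ' : Equiv.Perm (Fin n)} (ht : tops τ = tops τ')
    (hb : bots τ = bots τ') (hl : ∀ x, 1 ≤ x → x ≤ n → lesAt τ x = lesAt τ' x) : τ = τ' := by
  have key : ∀ k ≤ n, ∀ x, 1 ≤ x → x ≤ k →
      dropsBelow τ k (pext n τ⁻¹ x) = dropsBelow τ' k (pext n τ'⁻¹ x) ∧
      ∀ y, 1 ≤ y → y ≤ k → (pext n τ⁻¹ x < pext n τ⁻¹ y ↔ pext n τ'⁻¹ x < pext n τ'⁻¹ y) := by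
    intro k
    induction k with
    | zero => intros; omega
    | succ k ih =>
      intro hk
      have ih := ih (by omega)
      have hlt : ∀ x, 1 ≤ x → x ≤ k →
          (pext n τ⁻¹ x < pext n τ⁻¹ (k + 1) ↔ pext n τ'⁻¹ x < pext n τ'⁻¹ (k + 1)) := by
        intro x h1 h2
        rw [pext_inv_lt_iff hk ⟨h1, h2⟩, pext_inv_lt_iff hk ⟨h1, h2⟩, (ih x h1 h2).1,
          hl _ (by omega) hk]
      have hne : ∀ (ρ : Equiv.Perm (Fin n)) x, 1 ≤ x → x ≤ k →
          pext n ρ⁻¹ x ≠ pext n ρ⁻¹ (k + 1) := fun ρ x h1 h2 =>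
        pext_inv_ne (by omega) (by omega) (by omega)
      intro x h1 h2
      constructor
      · have s := dropsBelow_succ (τ := τ) hk (pext_mem τ⁻¹ (i := x) (by omega)).2
        have s' := dropsBelow_succ (τ := τ') hk (pext_mem τ'⁻¹ (i := x) (by omega)).2
        rw [ht, hb] at s
        rcases Nat.lt_or_ge k x with h | h
        · obtain rfl : x = k + 1 := by omega
          rw [← lesAt_eq_dropsBelow hk, hl _ h1 hk] at s
          rw [← lesAt_eq_dropsBelow hk] at s'
          simp only [lt_irrefl, le_refl, and_true, and_false] at s s'
          omega
        · have hx := hlt x h1 h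
          have n1 := hne τ x h1 h
          have n2 := hne τ' x h1 h
          have c1 : pext n τ⁻¹ (k + 1) < pext n τ⁻¹ x ↔ pext n τ'⁻¹ (k + 1) < pext n τ'⁻¹ x := by
            omega
          have c2 : pext n τ⁻¹ (k + 1) ≤ pext n τ⁻¹ x ↔ pext n τ'⁻¹ (k + 1) ≤ pext n τ'⁻¹ x := by
            omega
          simp only [c1, c2, (ih x h1 h).1] at s
          omega
      · intro y h3 h4
        rcases Nat.lt_or_ge k x with h | h <;> rcases Nat.lt_or_ge k y with h' | h'
        · obtain rfl : x = k + 1 := by omega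
          obtain rfl : y = k + 1 := by omega
          simp
        · obtain rfl : x = k + 1 := by omega
          have := hlt y h3 h'
          have := hne τ y h3 h'
          have := hne τ' y h3 h'
          omega
        · obtain rfl : y = k + 1 := by omega
          exact hlt x h1 h
        · exact (ih x h1 h).2 y h3 h'
  have hval : ∀ (ρ : Equiv.Perm (Fin n)) (x : Fin n), pext n ρ⁻¹ (x + 1) = (ρ⁻¹ x : Fin n) + 1 := by
    intro ρ x
    have : 1 ≤ (x : ℕ) + 1 ∧ (x : ℕ) + 1 ≤ n := by omega
    unfold pext
    rw [dif_pos this]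
    rfl
  have hmono : StrictMono (τ⁻¹ * τ' : Equiv.Perm (Fin n)) := by
    intro i j hij
    have := ((key n le_rfl (τ' i + 1) (by omega) (by omega)).2 (τ' j + 1) (by omega) (by omega)).2
    rw [hval, hval, hval, hval] at this
    simp only [Equiv.Perm.coe_inv, Equiv.symm_apply_apply] at this
    have := this (by omega)
    simp only [Equiv.Perm.coe_mul, Equiv.Perm.coe_inv, Function.comp_apply]
    omega
  have h1 : (τ⁻¹ * τ' : Equiv.Perm (Fin n)) = 1 := by
    ext i
    have := congrArg (fun f : Fin n ≃o Fin n => f i)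
      (Subsingleton.elim (StrictMono.orderIsoOfSurjective _ hmono (Equiv.surjective _))
        (OrderIso.refl _))
    simpa using congrArg Fin.val this
  exact inv_mul_eq_one.1 h1

end

section Matching

variable {α : Type*} [LinearOrder α]

lemma exists_mem_card_lt_eq (S : Finset α) {k : ℕ} (hk : k < S.card) :
    ∃ b ∈ S, (S.filter (· < b)).card = k := by
  refine ⟨S.orderEmbOfFin rfl ⟨k, hk⟩, orderEmbOfFin_mem _ _ _, ?_⟩
  have : S.filter (· < S.orderEmbOfFin rfl ⟨k, hk⟩) =
      (univ.filter (· < (⟨k, hk⟩ : Fin S.card))).map (S.orderEmbOfFin rfl).toEmbedding := by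
    ext x
    simp only [mem_filter, mem_map, mem_univ, true_and]
    constructor
    · rintro ⟨hx, h⟩
      obtain ⟨i, rfl⟩ : x ∈ Set.range (S.orderEmbOfFin rfl) := by
        rw [range_orderEmbOfFin]; exact hx
      exact ⟨i, by simpa using h, rfl⟩
    · rintro ⟨i, hi, rfl⟩
      exact ⟨orderEmbOfFin_mem _ _ _, by simpa using hi⟩
  rw [this, card_map, filter_gt_eq_Iio, Fin.card_Iio]

/-- A matching of `T` into `B`, compatible with a relation that is monotone in `T` and antitone
in `B`, with prescribed nesting numbers. -/
theorem exists_matching (R : α → α → Prop) [dR : DecidableRel R]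
    (hR : ∀ t t' b b', t ≤ t' → b' ≤ b → R t b → R t' b') (c : α → ℕ) (T : Finset α) :
    ∀ B : Finset α, T.card = B.card →
      (∀ t ∈ T, c t + (T.filter (· < t)).card < (B.filter (R t)).card) →
      ∃ φ : α → α, (∀ t ∈ T, φ t ∈ B ∧ R t (φ t)) ∧ Set.InjOn φ T ∧
        ∀ t ∈ T, (T.filter fun t' => t < t' ∧ φ t' < φ t).card = c t := by
  induction T using Finset.induction_on_min with
  | empty => intro B _ _; exact ⟨id, by simp⟩
  | insert a s ha ih =>
    intro B hcard hc
    have has : a ∉ s := fun h => lt_irrefl _ (ha a h)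
    have h0 := hc a (mem_insert_self _ _)
    obtain ⟨b, hb, hbc⟩ := exists_mem_card_lt_eq _ (lt_of_le_of_lt (Nat.le_add_right _ _) h0)
    rw [mem_filter] at hb
    have hbc' : ((B.erase b).filter (· < b)).card = c a := by
      rw [← hbc, filter_filter]
      congr 1
      ext x
      simp only [mem_filter, mem_erase]
      exact ⟨fun h => ⟨h.1.2, hR _ _ _ _ le_rfl h.2.le hb.2, h.2⟩,
        fun h => ⟨⟨h.2.2.ne, h.1⟩, h.2.2⟩⟩
    have hcard' : s.card = (B.erase b).card := by
      rw [card_insert_of_notMem has] at hcard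
      rw [card_erase_of_mem hb.1]; omega
    obtain ⟨φ, hφ, hinj, hφc⟩ := ih (B.erase b) hcard' (by
      intro t ht
      have h1 := hc t (mem_insert_of_mem ht)
      rw [filter_insert, if_pos (ha t ht), card_insert_of_notMem (by simp [has])] at h1
      have h2 : (B.filter (R t)).card ≤ ((B.erase b).filter (R t)).card + 1 := by
        rw [filter_erase]
        have := pred_card_le_card_erase (s := B.filter (R t)) (a := b)
        omega
      omega)
    have hup : ∀ t ∈ s, Function.update φ a b t = φ t := fun t ht =>
      Function.update_of_ne (ha t ht).ne' _ _
    have himg : s.image φ = B.erase b := by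
      refine eq_of_subset_of_card_le ?_ ?_
      · intro x hx
        obtain ⟨t, ht, rfl⟩ := mem_image.1 hx
        exact (hφ t ht).1
      · rw [card_image_of_injOn hinj, hcard']
    refine ⟨Function.update φ a b, ?_, ?_, ?_⟩
    · intro t ht
      rcases mem_insert.1 ht with rfl | ht
      · simpa using hb
      · rw [hup t ht]
        exact ⟨mem_of_mem_erase (hφ t ht).1, (hφ t ht).2⟩
    · rw [coe_insert, Set.injOn_insert (by simpa using has)]
      refine ⟨hinj.congr fun t ht => (hup t ht).symm, ?_⟩
      rintro ⟨t, ht, h⟩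
      rw [hup t ht, Function.update_self] at h
      exact ne_of_mem_erase (hφ t ht).1 h
    · intro t ht
      rcases mem_insert.1 ht with rfl | ht
      · rw [Function.update_self, filter_insert, if_neg (by simp), ← hbc', ← himg, filter_image,
          card_image_of_injOn (hinj.mono fun _ h => (mem_filter.1 h).1)]
        congr 1
        refine filter_congr fun x hx => ?_
        rw [hup x hx]
        simp [ha x hx]
      · rw [← hφc t ht, hup t ht, filter_insert, if_neg (by simp [(ha t ht).le])]
        congr 1
        refine filter_congr fun x hx => ?_
        rw [hup x hx]

theorem exists_matching_dual (R : α → α → Prop) [dR : DecidableRel R]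
    (hR : ∀ t t' b b', t' ≤ t → b ≤ b' → R t b → R t' b') (c : α → ℕ) (T B : Finset α)
    (hcard : T.card = B.card)
    (hc : ∀ t ∈ T, c t + (T.filter (t < ·)).card < (B.filter (R t)).card) :
    ∃ φ : α → α, (∀ t ∈ T, φ t ∈ B ∧ R t (φ t)) ∧ Set.InjOn φ T ∧
      ∀ t ∈ T, (T.filter fun t' => t' < t ∧ φ t < φ t').card = c t :=
  exists_matching (α := αᵒᵈ) R (dR := dR) (fun t t' b b' => hR t t' b b') c T B hcard hc

end Matching

section

variable {n : ℕ}

lemma lt_pextC_iff {τ : Equiv.Perm (Fin n)} {i : ℕ} (hi : 1 ≤ i ∧ i ≤ n) :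
    (pextC n τ i < pextC n τ (i - 1) ↔ pext n τ i ∈ bots τ) ∧
    (pextC n τ (i - 1) < pextC n τ i ↔ pext n τ i ∉ bots τ) ∧
    (pextC n τ (i + 1) < pextC n τ i ↔ pext n τ i ∈ tops τ) ∧
    (pextC n τ i < pextC n τ (i + 1) ↔ pext n τ i ∉ tops τ) := by
  have hC : ∀ {j}, 1 ≤ j ∧ j ≤ n → pextC n τ j = pext n τ j := by
    intro j hj
    simp only [pextC, pext, dif_pos hj]
  have hm := pext_mem τ hi
  have hne : ∀ j, 1 ≤ j ∧ j ≤ n → j ≠ i → pext n τ j ≠ pext n τ i := by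
    intro j hj hji h
    rw [pext_eq_iff τ hj hm, pext_inv_pext τ hi] at h
    exact hji h
  have h1 : (i = 1 ∧ pextC n τ (i - 1) = 0 ∧ pext n τ (i - 1) = 0) ∨
      (i ≠ 1 ∧ pextC n τ (i - 1) = pext n τ (i - 1) ∧ pext n τ (i - 1) ≠ pext n τ i) := by
    by_cases h : i = 1
    · exact Or.inl (by simp [h, pextC, pext])
    · exact Or.inr ⟨h, hC (by omega), hne _ (by omega) (by omega)⟩
  have h2 : (i = n ∧ pextC n τ (i + 1) = n + 1) ∨
      (i < n ∧ pextC n τ (i + 1) = pext n τ (i + 1) ∧ pext n τ (i + 1) ≠ pext n τ i) := by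
    by_cases h : i = n
    · exact Or.inl (by simp [h, pextC])
    · exact Or.inr ⟨by omega, hC (by omega), hne _ (by omega) (by omega)⟩
  rw [pext_mem_tops hi, pext_mem_bots hi, hC hi]
  omega

variable (τ : Equiv.Perm (Fin n))

lemma valleyC_eq :
    valleyC n τ = ((Icc 1 n).filter fun x => x ∈ bots τ ∧ x ∉ tops τ).card := by
  rw [← card_filter_pext τ, valleyC]
  congr 1
  refine filter_congr fun i hi => ?_
  have := lt_pextC_iff (τ := τ) (mem_Icc.1 hi)
  tauto

lemma ddC_eq : ddC n τ = ((Icc 1 n).filter fun x => x ∈ bots τ ∧ x ∈ tops τ).card := by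
  rw [← card_filter_pext τ, ddC]
  congr 1
  refine filter_congr fun i hi => ?_
  have := lt_pextC_iff (τ := τ) (mem_Icc.1 hi)
  tauto

lemma daC_eq : daC n τ = ((Icc 1 n).filter fun x => x ∉ bots τ ∧ x ∉ tops τ).card := by
  rw [← card_filter_pext τ, daC]
  congr 1
  refine filter_congr fun i hi => ?_
  have := lt_pextC_iff (τ := τ) (mem_Icc.1 hi)
  tauto

lemma forall_lt_iff_lesAt_eq_zero {τ : Equiv.Perm (Fin n)} {i : ℕ} (hi : 1 ≤ i ∧ i ≤ n)
    (hb : pext n τ i ∉ bots τ) :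
    (∀ j ∈ Ico 1 i, pext n τ j < pext n τ i) ↔ lesAt τ (pext n τ i) = 0 := by
  rw [pext_mem_bots hi, not_lt] at hb
  rw [lesAt, card_eq_zero, filter_eq_empty_iff, pext_inv_pext τ hi]
  have hm := pext_mem τ hi
  have hne : ∀ j, 1 ≤ j → j < i → pext n τ j ≠ pext n τ i := by
    intro j hj hji h
    rw [pext_eq_iff τ (by omega) hm, pext_inv_pext τ hi] at h
    omega
  constructor
  · intro h j hj hl
    have := h (j - 1) (mem_Ico.2 (by omega))
    omega
  · intro h j hj
    rw [mem_Ico] at hj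
    by_contra hlt
    have := hne j hj.1 hj.2
    have hji : j ≠ i - 1 := by rintro rfl; omega
    have := hne (i - 1) (by omega) (by omega)
    obtain ⟨r, h1, h2, h3, h4⟩ := exists_drop_between (τ := τ) (k := pext n τ i - 1) (q := j)
      (r := i - 1) (by omega) (by omega) (by omega)
    have := hne (r - 1) (by omega) (by omega)
    exact h (x := r) (mem_Icc.2 (by omega)) (by omega)

lemma fmaxStat_eq : fmaxStat n τ =
    ((Icc 1 n).filter fun x => (x ∉ bots τ ∧ x ∉ tops τ) ∧ lesAt τ x = 0).card := by
  rw [← card_filter_pext τ, fmaxStat]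
  congr 1
  ext i
  simp only [mem_filter, mem_Icc]
  refine and_congr_right fun hi => ?_
  have h1 := lt_pextC_iff (τ := τ) hi
  have h2 := forall_lt_iff_lesAt_eq_zero (τ := τ) hi
  tauto

end

section

variable {n : ℕ} (σ : Equiv.Perm (Fin n))

/-- The set of drop positions. -/
def drops : Finset ℕ := (Icc 1 n).filter fun i => pext n σ i < i

/-- The set of drop values. -/
def dropVals : Finset ℕ := (Icc 1 n).filter fun x => x < pext n σ⁻¹ x

/-- The number of crossings with second coordinate `j`. -/
def crosAt (j : ℕ) : ℕ :=
  ((Icc 1 n).filter fun i =>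
    (i < j ∧ j ≤ pext n σ i ∧ pext n σ i < pext n σ j) ∨
    (j < i ∧ pext n σ i < j ∧ pext n σ j < pext n σ i)).card

/-- The number of nestings with second coordinate `j`. -/
def nestAt (j : ℕ) : ℕ :=
  ((Icc 1 n).filter fun i =>
    (i < j ∧ j ≤ pext n σ j ∧ pext n σ j < pext n σ i) ∨
    (j < i ∧ pext n σ j < j ∧ pext n σ i < pext n σ j)).card

lemma crosStat_eq_sum : crosStat n σ = ∑ j ∈ Icc 1 n, crosAt σ j := by
  simp only [crosStat, crosAt, card_filter, pairs, sum_product_right]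

lemma nestStat_eq_sum : nestStat n σ = ∑ j ∈ Icc 1 n, nestAt σ j := by
  simp only [nestStat, nestAt, card_filter, pairs, sum_product_right]

lemma card_filter_dropVals (P : ℕ → Prop) [DecidablePred P] :
    ((dropVals σ).filter P).card =
      ((Icc 1 n).filter fun i => pext n σ i < i ∧ P (pext n σ i)).card := by
  rw [dropVals, filter_filter, ← card_filter_pext σ]
  congr 1
  refine filter_congr fun i hi => ?_
  rw [pext_inv_pext σ (mem_Icc.1 hi)]

lemma card_dropVals : (dropVals σ).card = (drops σ).card := by
  simpa [drops] using card_filter_dropVals σ fun _ => True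

variable {σ}

lemma crosAt_add_nestAt {j : ℕ} (hj : 1 ≤ j ∧ j ≤ n) :
    crosAt σ j + nestAt σ j + ((drops σ).filter (· ≤ j)).card =
      ((dropVals σ).filter (· < j)).card := by
  have hne : ∀ i, 1 ≤ i ∧ i ≤ n → (pext n σ i = pext n σ j ↔ i = j) := by
    intro i hi
    rw [pext_eq_iff σ hi (pext_mem σ hj), pext_inv_pext σ hj]
  rw [card_filter_dropVals, crosAt, nestAt, drops, filter_filter]
  by_cases hd : pext n σ j < j
  · simp only [card_filter, ← sum_add_distrib]
    refine sum_congr rfl fun i hi => ?_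
    have := hne i (mem_Icc.1 hi)
    split_ifs <;> omega
  · have h := card_filter_pext σ (· < j)
    rw [← Nat.add_right_cancel_iff (n := ((Icc 1 n).filter fun i => pext n σ i < j).card)]
    conv_rhs => rw [h]
    simp only [card_filter, ← sum_add_distrib]
    refine sum_congr rfl fun i hi => ?_
    have := hne i (mem_Icc.1 hi)
    split_ifs <;> omega

lemma pext_inv_eq_self_iff {x : ℕ} (hx : 1 ≤ x ∧ x ≤ n) :
    pext n σ⁻¹ x = x ↔ pext n σ x = x := by
  rw [pext_eq_iff σ hx hx, eq_comm]

lemma pext_eq_self_iff {x : ℕ} (hx : 1 ≤ x ∧ x ≤ n) :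
    pext n σ x = x ↔ (x ∉ dropVals σ ∧ x ∉ drops σ) ∧ crosAt σ x = 0 := by
  have hf := pext_inv_eq_self_iff (σ := σ) hx
  simp only [dropVals, drops, mem_filter, mem_Icc, hx, and_self, true_and, not_lt, crosAt,
    card_eq_zero, filter_eq_empty_iff]
  constructor
  · intro h
    refine ⟨by omega, fun i hi => by omega⟩
  · rintro ⟨⟨h1, h2⟩, h3⟩
    by_contra hne
    have := h3 (pext_mem σ⁻¹ hx)
    rw [pext_pext_inv σ hx] at this
    omega

lemma cdaStat_add_fixStat : cdaStat n σ + fixStat n σ =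
    ((Icc 1 n).filter fun x => x ∉ dropVals σ ∧ x ∉ drops σ).card := by
  simp only [cdaStat, fixStat, card_filter, ← sum_add_distrib]
  refine sum_congr rfl fun x hx => ?_
  have hf := pext_inv_eq_self_iff (σ := σ) (mem_Icc.1 hx)
  simp only [dropVals, drops, mem_filter, hx, true_and, not_lt]
  split_ifs <;> omega

lemma cvalleyStat_eq : cvalleyStat n σ =
    ((Icc 1 n).filter fun x => x ∈ dropVals σ ∧ x ∉ drops σ).card := by
  rw [cvalleyStat]
  congr 1
  refine filter_congr fun x hx => ?_
  have hf := pext_inv_eq_self_iff (σ := σ) (mem_Icc.1 hx)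
  simp only [dropVals, drops, mem_filter, hx, true_and, not_lt]
  omega

lemma cddStat_eq : cddStat n σ =
    ((Icc 1 n).filter fun x => x ∈ dropVals σ ∧ x ∈ drops σ).card := by
  rw [cddStat]
  congr 1
  refine filter_congr fun x hx => ?_
  simp only [dropVals, drops, mem_filter, hx, true_and]

lemma exists_pext_eq (s : ℕ → ℕ) (hs : ∀ i, 1 ≤ i ∧ i ≤ n → 1 ≤ s i ∧ s i ≤ n)
    (hinj : ∀ i j, 1 ≤ i ∧ i ≤ n → 1 ≤ j ∧ j ≤ n → s i = s j → i = j) :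
    ∃ σ : Equiv.Perm (Fin n), ∀ i, 1 ≤ i ∧ i ≤ n → pext n σ i = s i := by
  let f : Fin n → Fin n := fun i => ⟨s (i + 1) - 1, by have := hs (i + 1) (by omega); omega⟩
  have hf : Function.Injective f := by
    intro i j hij
    have h1 := hs (i + 1) (by omega)
    have h2 := hs (j + 1) (by omega)
    have h3 : s (i + 1) - 1 = s (j + 1) - 1 := congrArg Fin.val hij
    have := hinj (i + 1) (j + 1) (by omega) (by omega) (by omega)
    omega
  refine ⟨Equiv.ofBijective f (Finite.injective_iff_bijective.1 hf), fun i hi => ?_⟩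
  have := hs i hi
  simp only [pext, dif_pos hi, Equiv.ofBijective_apply, f, Nat.sub_add_cancel hi.1]
  omega

lemma card_filter_sdiff_add {S A : Finset ℕ} (h : S ⊆ A) (P : ℕ → Prop) [DecidablePred P] :
    ((A \ S).filter P).card + (S.filter P).card = (A.filter P).card := by
  rw [← card_union_of_disjoint (disjoint_filter_filter sdiff_disjoint), ← filter_union,
    sdiff_union_of_subset h]

/-- Permutations with prescribed drop positions, drop values and nesting numbers. -/
theorem exists_perm_of_drops {T B : Finset ℕ} (hT : T ⊆ Icc 1 n) (hB : B ⊆ Icc 1 n)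
    (hcard : T.card = B.card) (c : ℕ → ℕ)
    (hc : ∀ j, 1 ≤ j ∧ j ≤ n → c j + (T.filter (· ≤ j)).card ≤ (B.filter (· < j)).card) :
    ∃ σ : Equiv.Perm (Fin n), drops σ = T ∧ dropVals σ = B ∧
      ∀ j, 1 ≤ j ∧ j ≤ n → nestAt σ j = c j := by
  obtain ⟨φ, hφ, hφi, hφc⟩ := exists_matching (fun t b => b < t)
    (fun t t' b b' h1 h2 h3 => h2.trans_lt (h3.trans_le h1)) c T B hcard (by
      intro t ht
      refine lt_of_lt_of_le (Nat.add_lt_add_left (card_lt_card ?_) _) (hc t (mem_Icc.1 (hT ht)))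
      refine ⟨monotone_filter_right _ fun _ _ h => le_of_lt h, fun h => ?_⟩
      exact lt_irrefl t (mem_filter.1 (h (mem_filter.2 ⟨ht, le_rfl⟩))).2)
  obtain ⟨ψ, hψ, hψi, hψc⟩ := exists_matching_dual (fun t b => t ≤ b)
    (fun t t' b b' h1 h2 h3 => h1.trans (h3.trans h2)) c (Icc 1 n \ T) (Icc 1 n \ B)
    (by rw [card_sdiff_of_subset hT, card_sdiff_of_subset hB, hcard]) (by
      intro t ht
      have ht' := mem_Icc.1 (mem_sdiff.1 ht).1
      have h1 := hc t ht'
      have h2 := card_filter_sdiff_add hT (t < ·)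
      have h3 := card_filter_sdiff_add hB (t ≤ ·)
      have h4 := card_filter_add_card_filter_not (s := T) (· ≤ t)
      have h5 := card_filter_add_card_filter_not (s := B) (· < t)
      simp only [not_le, not_lt] at h4 h5
      have h6 : (Icc 1 n).filter (t < ·) = Icc (t + 1) n := by
        ext; simp only [mem_filter, mem_Icc]; omega
      have h7 : (Icc 1 n).filter (t ≤ ·) = Icc t n := by
        ext; simp only [mem_filter, mem_Icc]; omega
      rw [h6, Nat.card_Icc] at h2
      rw [h7, Nat.card_Icc] at h3
      omega)
  have hmem : ∀ i, 1 ≤ i ∧ i ≤ n → i ∉ T → i ∈ Icc 1 n \ T := fun i hi h =>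
    mem_sdiff.2 ⟨mem_Icc.2 hi, h⟩
  obtain ⟨σ, hσ⟩ := exists_pext_eq (n := n) (fun i => if i ∈ T then φ i else ψ i) (by
    intro i hi
    rw [← mem_Icc]
    by_cases h : i ∈ T
    · simpa only [if_pos h] using hB (hφ i h).1
    · simpa only [if_neg h] using (mem_sdiff.1 (hψ i (hmem i hi h)).1).1) (by
    intro i j hi hj hij
    by_cases h : i ∈ T <;> by_cases h' : j ∈ T
    · simp only [if_pos h, if_pos h'] at hij
      exact hφi h h' hij
    · simp only [if_pos h, if_neg h'] at hij
      exact absurd (hij ▸ (hφ i h).1) (mem_sdiff.1 (hψ j (hmem j hj h')).1).2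
    · simp only [if_neg h, if_pos h'] at hij
      exact absurd (hij ▸ (hφ j h').1) (mem_sdiff.1 (hψ i (hmem i hi h)).1).2
    · simp only [if_neg h, if_neg h'] at hij
      exact hψi (hmem i hi h) (hmem j hj h') hij)
  have h1 : ∀ i ∈ T, pext n σ i = φ i := fun i h => by rw [hσ i (mem_Icc.1 (hT h)), if_pos h]
  have h2 : ∀ i, 1 ≤ i ∧ i ≤ n → i ∉ T → pext n σ i = ψ i := fun i hi h => by
    rw [hσ i hi, if_neg h]
  have hlt : ∀ i, 1 ≤ i ∧ i ≤ n → (pext n σ i < i ↔ i ∈ T) := by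
    intro i hi
    by_cases h : i ∈ T
    · simpa only [h1 i h, h, iff_true] using (hφ i h).2
    · simpa only [h2 i hi h, h, iff_false, not_lt] using (hψ i (hmem i hi h)).2
  have hdT : drops σ = T := by
    ext i
    simp only [drops, mem_filter, mem_Icc]
    exact ⟨fun h => (hlt i h.1).1 h.2, fun h =>
      have hi := mem_Icc.1 (hT h)
      ⟨hi, (hlt i hi).2 h⟩⟩
  refine ⟨σ, hdT, ?_, ?_⟩
  · refine eq_of_subset_of_card_le ?_ (by rw [card_dropVals, hdT, hcard])
    intro x hx
    simp only [dropVals, mem_filter, mem_Icc] at hx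
    have hp := pext_mem σ⁻¹ hx.1
    have hx' := pext_pext_inv σ hx.1
    have hpT : pext n σ⁻¹ x ∈ T := (hlt _ hp).1 (by omega)
    rw [← hx', h1 _ hpT]
    exact (hφ _ hpT).1
  · intro j hj
    by_cases h : j ∈ T
    · rw [← hφc j h, nestAt]
      congr 1
      ext i
      simp only [mem_filter, mem_Icc]
      have hj' := (hlt j hj).2 h
      constructor
      · rintro ⟨hi, hn⟩
        have hiT : i ∈ T := (hlt i hi).1 (by omega)
        rw [← h1 i hiT, ← h1 j h]
        exact ⟨hiT, by omega⟩
      · rintro ⟨hiT, hn⟩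
        rw [← h1 i hiT, ← h1 j h] at hn
        exact ⟨mem_Icc.1 (hT hiT), by omega⟩
    · rw [← hψc j (hmem j hj h), nestAt]
      congr 1
      ext i
      simp only [mem_filter, mem_sdiff, mem_Icc]
      have hj' := mt (hlt j hj).1 h
      constructor
      · rintro ⟨hi, hn⟩
        have hiT : i ∉ T := mt (hlt i hi).2 (by omega)
        rw [← h2 i hi hiT, ← h2 j hj h]
        exact ⟨⟨hi, hiT⟩, by omega⟩
      · rintro ⟨⟨hi, hiT⟩, hn⟩
        rw [← h2 i hi hiT, ← h2 j hj h] at hn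
        exact ⟨hi, by omega⟩

/-- Transport of the descent data of `τ` to the drop data of a permutation. -/
theorem exists_perm_of_tops_bots (τ : Equiv.Perm (Fin n)) :
    ∃ σ : Equiv.Perm (Fin n), drops σ = tops τ ∧ dropVals σ = bots τ ∧
      (∀ x, 1 ≤ x ∧ x ≤ n → nestAt σ x = ressAt τ x) ∧
      ∀ x, 1 ≤ x ∧ x ≤ n → crosAt σ x = lesAt τ x := by
  obtain ⟨σ, h1, h2, h3⟩ := exists_perm_of_drops (n := n) (T := tops τ) (B := bots τ)
    (filter_subset _ _) (filter_subset _ _) (card_bots_eq_card_tops τ).symm (ressAt τ) (by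
      intro j hj
      have := lesAt_add_ressAt (τ := τ) hj
      omega)
  refine ⟨σ, h1, h2, h3, fun x hx => ?_⟩
  have e1 := lesAt_add_ressAt (τ := τ) hx
  have e2 := crosAt_add_nestAt (σ := σ) hx
  rw [h1, h2, h3 x hx] at e2
  omega

end

theorem statement4 (n : ℕ) (hn : 1 ≤ n) :
    ∃ Φ : Equiv.Perm (Fin n) → Equiv.Perm (Fin n), Function.Bijective Φ ∧
      ∀ σ : Equiv.Perm (Fin n),
        nestStat n σ = ressStat n (Φ σ) ∧
        crosStat n σ = lesStat n (Φ σ) ∧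
        dropStat n σ = desStat n (Φ σ) ∧
        cdaStat n σ = daC n (Φ σ) - fmaxStat n (Φ σ) ∧
        cddStat n σ = ddC n (Φ σ) ∧
        cvalleyStat n σ = valleyC n (Φ σ) ∧
        fixStat n σ = fmaxStat n (Φ σ) := by
  choose Ψ hT hB hr hl using exists_perm_of_tops_bots (n := n)
  have hinj : Function.Injective Ψ := fun τ τ' h =>
    eq_of_tops_bots_lesAt (by rw [← hT, h, hT]) (by rw [← hB, h, hB]) fun x h1 h2 => by
      rw [← hl _ x ⟨h1, h2⟩, h, hl _ x ⟨h1, h2⟩]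
  let e := Equiv.ofBijective Ψ (Finite.injective_iff_bijective.1 hinj)
  refine ⟨e.symm, e.symm.bijective, e.surjective.forall.2 fun τ => ?_⟩
  rw [e.symm_apply_apply, show e τ = Ψ τ from rfl]
  have hfix : fixStat n (Ψ τ) = fmaxStat n τ := by
    rw [fmaxStat_eq, fixStat, ← hT, ← hB]
    congr 1
    refine filter_congr fun x hx => ?_
    rw [pext_eq_self_iff (mem_Icc.1 hx), hl τ x (mem_Icc.1 hx)]
  refine ⟨?_, ?_, ?_, ?_, ?_, ?_, hfix⟩
  · rw [nestStat_eq_sum, ressStat_eq_sum]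
    exact sum_congr rfl fun x hx => hr τ x (mem_Icc.1 hx)
  · rw [crosStat_eq_sum, lesStat_eq_sum]
    exact sum_congr rfl fun x hx => hl τ x (mem_Icc.1 hx)
  · rw [desStat_eq_card_tops, ← hT]
    rfl
  · rw [← hfix, daC_eq, ← hT, ← hB, ← cdaStat_add_fixStat, Nat.add_sub_cancel]
  · rw [cddStat_eq, ddC_eq, hT, hB]
  · rw [cvalleyStat_eq, valleyC_eq, hT, hB]

end SZpaper
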